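/- (Convergence rate of connected trade dynamics) Let ρ_1, …, ρ_N be expressive, strictly risk averse convex risk measures on ℝ^k, each ρ_i being σ_i-smooth (∇ρ_i is σ_i-Lipschitz), let r⁰ ∈ (ℝ^k)^N be initial positions, and let D be any connected trade dynamic. Let (r^t)_{t≥0} be the random sequence of position profiles generated by D from r⁰ (at each step an independently drawn trade function f_i, chosen with probability p_i, is applied). Then there is a constant C (depending on the ρ_i, r⁰, and D but not on t) such that E[Φ(r^t)] ≤ C/t for all t ≥ 1; in particular E[Φ(r^t)] = O(1/t). -/

import Mathlib

open scoped RealInnerProductSpace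

/-- A (normalized) convex monetary risk measure on positions `r ∈ ℝ^k`, where the
position `r` pays `⟨r, φ(ω)⟩` on outcome `ω` and `rcash` is the riskless bundle
paying `1` on every outcome. -/
structure IsConvexRiskMeasure {k : ℕ} {Ω : Type*} [Fintype Ω]
    (φ : Ω → EuclideanSpace ℝ (Fin k)) (rcash : EuclideanSpace ℝ (Fin k))
    (ρ : EuclideanSpace ℝ (Fin k) → ℝ) : Prop where
  monotone : ∀ r r' : EuclideanSpace ℝ (Fin k),
    (∀ ω, ⟪r, φ ω⟫ ≤ ⟪r', φ ω⟫) → ρ r' ≤ ρ r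
  cash_invariant : ∀ (r : EuclideanSpace ℝ (Fin k)) (c : ℝ), ρ (r + c • rcash) = ρ r - c
  convex : ConvexOn ℝ Set.univ ρ
  normalized : ρ 0 = 0

/-- `ρ` is expressive: everywhere differentiable, with gradient range dense in `−Π`,
where `Π = conv(φ(Ω))`. -/
def Expressive {k : ℕ} {Ω : Type*} [Fintype Ω]
    (φ : Ω → EuclideanSpace ℝ (Fin k)) (ρ : EuclideanSpace ℝ (Fin k) → ℝ) : Prop :=
  (∀ x, DifferentiableAt ℝ ρ x) ∧
    closure (Set.range fun x => gradient ρ x) =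
      (fun π => -π) '' convexHull ℝ (Set.range φ)

/-- `ρ` is strictly risk averse: the convexity inequality is strict unless the
difference of the two positions is a multiple of the riskless bundle `rcash`. -/
def StrictlyRiskAverse {k : ℕ} (rcash : EuclideanSpace ℝ (Fin k))
    (ρ : EuclideanSpace ℝ (Fin k) → ℝ) : Prop :=
  ∀ r r' : EuclideanSpace ℝ (Fin k), ∀ t : ℝ, t ∈ Set.Ioo (0 : ℝ) 1 →
    (∀ c : ℝ, r - r' ≠ c • rcash) →
      ρ (t • r + (1 - t) • r') < t * ρ r + (1 - t) * ρ r'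

/-- The infimal convolution `(∧_{i∈S} ρ_i)(r) = inf {Σ_{i∈S} ρ_i(r_i) : Σ_{i∈S} r_i = r}`
of the risk measures indexed by `S`. -/
noncomputable def wedgeRisk {k N : ℕ} (S : Finset (Fin N))
    (ρ : Fin N → EuclideanSpace ℝ (Fin k) → ℝ) (r : EuclideanSpace ℝ (Fin k)) : ℝ :=
  sInf {s : ℝ | ∃ rs : Fin N → EuclideanSpace ℝ (Fin k),
    (∑ i ∈ S, rs i) = r ∧ s = ∑ i ∈ S, ρ i (rs i)}

/-- The `S`-surplus `Φ_S(r_S) = Σ_{i∈S} ρ_i(r_i) − (∧_{i∈S} ρ_i)(Σ_{i∈S} r_i)`. -/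
noncomputable def surplus {k N : ℕ} (S : Finset (Fin N))
    (ρ : Fin N → EuclideanSpace ℝ (Fin k) → ℝ)
    (r : Fin N → EuclideanSpace ℝ (Fin k)) : ℝ :=
  (∑ i ∈ S, ρ i (r i)) - wedgeRisk S ρ (∑ i ∈ S, r i)

/-- A trade function on `S`: it preserves the total position of `S`, allocates the whole
`S`-surplus, and leaves agents outside `S` untouched. -/
def IsTradeFunction {k N : ℕ} (S : Finset (Fin N))
    (ρ : Fin N → EuclideanSpace ℝ (Fin k) → ℝ)
    (f : (Fin N → EuclideanSpace ℝ (Fin k)) → Fin N → EuclideanSpace ℝ (Fin k)) : Prop :=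
  ∀ r, (∑ i ∈ S, f r i) = (∑ i ∈ S, r i) ∧ surplus S ρ (f r) = 0 ∧
    ∀ j ∉ S, f r j = r j

/-- The hypergraph on `{1,…,N}` with hyperedges `S_1, …, S_m` is connected: any two
nodes are joined by a chain of hyperedges. -/
def ConnectedHypergraph {N m : ℕ} (S : Fin m → Finset (Fin N)) : Prop :=
  ∀ a b : Fin N, Relation.ReflTransGen (fun u v => ∃ i, u ∈ S i ∧ v ∈ S i) a b

/-- The trajectory of an iterative (random) process: `traj x0 step t ω` is the state
after `t` steps started from `x0`, where the `s`-th step uses the random index `ω s`. -/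
def traj {β : Type*} {m : ℕ} (x0 : β) (step : β → Fin m → β) :
    (t : ℕ) → (Fin t → Fin m) → β
  | 0, _ => x0
  | t + 1, ω => step (traj x0 step t fun s => ω s.castSucc) (ω (Fin.last t))

/-- The gradient inequality for differentiable convex functions. -/
lemma ConvexOn.add_inner_gradient_le {E : Type*} [NormedAddCommGroup E] [InnerProductSpace ℝ E]
    [CompleteSpace E] {g : E → ℝ} (hg : ConvexOn ℝ Set.univ g) {x : E}
    (hx : DifferentiableAt ℝ g x) (y : E) : g x + ⟪gradient g x, y - x⟫ ≤ g y := by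
  have hline : ConvexOn ℝ Set.univ (fun t : ℝ => g (AffineMap.lineMap x y t)) := by
    exact hg.comp_affineMap (AffineMap.lineMap x y)
  have hd : HasDerivAt (fun t : ℝ => g (AffineMap.lineMap x y t)) ⟪gradient g x, y - x⟫ 0 := by
    have h1 : HasFDerivAt g (fderiv ℝ g x) (AffineMap.lineMap x y (0 : ℝ)) := by
      simpa using hx.hasFDerivAt
    have h2 := h1.comp_hasDerivAt (0 : ℝ) (AffineMap.hasDerivAt_lineMap (a := x) (b := y))
    rwa [← inner_gradient_left] at h2
  have := hline.le_slope_of_hasDerivAt (Set.mem_univ 0) (Set.mem_univ 1) one_pos hd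
  simp only [slope, sub_zero, inv_one, AffineMap.lineMap_apply_one, AffineMap.lineMap_apply_zero,
    vsub_eq_sub, one_smul] at this
  linarith

/-- A quadratic upper bound for convex functions with Lipschitz gradient. -/
lemma ConvexOn.le_add_inner_gradient_add_sq {E : Type*} [NormedAddCommGroup E]
    [InnerProductSpace ℝ E] [CompleteSpace E] {g : E → ℝ} (hg : ConvexOn ℝ Set.univ g)
    (hd : ∀ x, DifferentiableAt ℝ g x) {L : NNReal} (hL : LipschitzWith L (gradient g))
    (x d : E) : g (x + d) ≤ g x + ⟪gradient g x, d⟫ + L * ‖d‖ ^ 2 := by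
  have h1 := hg.add_inner_gradient_le (hd (x + d)) x
  have h2 : ‖gradient g (x + d) - gradient g x‖ ≤ L * ‖d‖ := by
    simpa [dist_eq_norm] using hL.dist_le_mul (x + d) x
  have h3 : ⟪gradient g (x + d) - gradient g x, d⟫ ≤ L * ‖d‖ * ‖d‖ :=
    (real_inner_le_norm _ _).trans (by gcongr)
  have h4 : x - (x + d) = -d := by abel
  rw [h4, inner_neg_right] at h1
  rw [inner_sub_left] at h3
  nlinarith

/-- A differentiable convex function having in every direction of the hyperplane `⟪·, c⟫ = 0`
some positive directional derivative grows at least linearly on that hyperplane. -/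
lemma ConvexOn.exists_linear_growth {E : Type*} [NormedAddCommGroup E]
    [InnerProductSpace ℝ E] [FiniteDimensional ℝ E] {g : E → ℝ} (hg : ConvexOn ℝ Set.univ g)
    (hd : ∀ x, DifferentiableAt ℝ g x) (c : E)
    (hpos : ∀ v, v ≠ 0 → ⟪v, c⟫ = 0 → ∃ x, 0 < ⟪gradient g x, v⟫) :
    ∃ δ > 0, ∃ K, ∀ v, ⟪v, c⟫ = 0 → δ * ‖v‖ - K ≤ g v := by
  have hcomp : IsCompact (Metric.sphere (0 : E) 1 ∩ {v | ⟪v, c⟫ = 0}) :=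
    (isCompact_sphere 0 1).inter_right (isClosed_eq (by fun_prop) (by fun_prop))
  have key : ∃ δ > 0, ∃ K, ∀ u ∈ Metric.sphere (0 : E) 1 ∩ {v | ⟪v, c⟫ = 0},
      ∀ t : ℝ, 0 ≤ t → δ * t - K ≤ g (t • u) := by
    refine hcomp.induction_on
      (p := fun T => ∃ δ > 0, ∃ K, ∀ u ∈ T, ∀ t : ℝ, 0 ≤ t → δ * t - K ≤ g (t • u))
      ⟨1, one_pos, 0, by simp⟩ ?_ ?_ ?_
    · rintro s t hst ⟨δ, hδ, K, h⟩
      exact ⟨δ, hδ, K, fun u hu => h u (hst hu)⟩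
    · rintro s t ⟨δ, hδ, K, h⟩ ⟨δ', hδ', K', h'⟩
      refine ⟨min δ δ', lt_min hδ hδ', max K K', ?_⟩
      rintro u (hu | hu) τ hτ
      · have := h u hu τ hτ
        have := mul_le_mul_of_nonneg_right (min_le_left δ δ') hτ
        linarith [le_max_left K K']
      · have := h' u hu τ hτ
        have := mul_le_mul_of_nonneg_right (min_le_right δ δ') hτ
        linarith [le_max_right K K']
    · rintro u ⟨hu, huc⟩
      have hu0 : u ≠ 0 := by
        rintro rfl
        simp at hu
      obtain ⟨x, hx⟩ := hpos u hu0 huc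
      set δ := ⟪gradient g x, u⟫ / 2 with hδ
      have hopen : IsOpen {w | δ < ⟪gradient g x, w⟫} :=
        isOpen_lt (by fun_prop) (by fun_prop)
      refine ⟨_, mem_nhdsWithin_of_mem_nhds (hopen.mem_nhds (show δ < _ by linarith)), δ,
        by positivity, ⟪gradient g x, x⟫ - g x, fun w hw t ht => ?_⟩
      have h1 := hg.add_inner_gradient_le (hd x) (t • w)
      rw [inner_sub_right, inner_smul_right] at h1
      have h2 : t * δ ≤ t * ⟪gradient g x, w⟫ :=
        mul_le_mul_of_nonneg_left (le_of_lt hw) ht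
      linarith
  obtain ⟨δ, hδ, K, h⟩ := key
  refine ⟨δ, hδ, max K (-g 0), fun v hv => ?_⟩
  rcases eq_or_ne v 0 with rfl | hv0
  · simp only [norm_zero, mul_zero]
    linarith [le_max_right K (-g 0)]
  · have hn : ‖v‖ ≠ 0 := norm_ne_zero_iff.mpr hv0
    have := h (‖v‖⁻¹ • v) ⟨by simp [norm_smul, hn], by simp [inner_smul_left, hv]⟩ ‖v‖
      (norm_nonneg v)
    rw [smul_inv_smul₀ hn] at this
    linarith [le_max_left K (-g 0)]

lemma inner_gradient_eq_neg_one_of_cash_invariant {E : Type*} [NormedAddCommGroup E]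
    [InnerProductSpace ℝ E] [CompleteSpace E] {g : E → ℝ} {e x : E}
    (hcash : ∀ (r : E) (c : ℝ), g (r + c • e) = g r - c) (hx : DifferentiableAt ℝ g x) :
    ⟪gradient g x, e⟫ = -1 := by
  rw [inner_gradient_left]
  have h1 : HasDerivAt (fun t : ℝ => g (x + t • e)) (fderiv ℝ g x e) 0 :=
    hx.hasFDerivAt.hasLineDerivAt e
  have h2 : HasDerivAt (fun t : ℝ => g (x + t • e)) (-1) 0 := by
    simp only [hcash]
    simpa using (hasDerivAt_id (0 : ℝ)).const_sub (g x)
  exact h1.unique h2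

/-- An expressive risk measure grows linearly on the positions whose average payoff is zero. -/
lemma Expressive.exists_linear_growth {k : ℕ} {Ω : Type*} [Fintype Ω]
    {φ : Ω → EuclideanSpace ℝ (Fin k)} {ρ : EuclideanSpace ℝ (Fin k) → ℝ}
    (hexp : Expressive φ ρ) (hconv : ConvexOn ℝ Set.univ ρ)
    (hspan : Submodule.span ℝ (Set.range φ) = ⊤) :
    ∃ δ > 0, ∃ K, ∀ v, ⟪v, ∑ ω, φ ω⟫ = 0 → δ * ‖v‖ - K ≤ ρ v := by
  refine hconv.exists_linear_growth hexp.1 _ fun v hv0 hv => ?_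
  obtain ⟨ω, hω⟩ : ∃ ω, ⟪v, φ ω⟫ < 0 := by
    by_contra! hcon
    rw [inner_sum, Finset.sum_eq_zero_iff_of_nonneg fun ω _ => hcon ω] at hv
    refine hv0 (inner_self_eq_zero (𝕜 := ℝ).mp ?_)
    have hmem : v ∈ Submodule.span ℝ (Set.range φ) := hspan ▸ Submodule.mem_top
    have hle : Submodule.span ℝ (Set.range φ) ≤ LinearMap.ker (innerₛₗ ℝ v) := by
      rw [Submodule.span_le]
      rintro _ ⟨ω, rfl⟩
      simpa using hv ω (Finset.mem_univ ω)
    simpa using hle hmem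
  have hcl : -φ ω ∈ closure (Set.range fun x => gradient ρ x) := by
    rw [hexp.2]
    exact ⟨φ ω, subset_convexHull ℝ _ ⟨ω, rfl⟩, rfl⟩
  have hopen : IsOpen {w | 0 < ⟪w, v⟫} := isOpen_lt (by fun_prop) (by fun_prop)
  obtain ⟨_, hw, x, rfl⟩ := mem_closure_iff.mp hcl _ hopen
    (by simpa [inner_neg_left, real_inner_comm] using hω)
  exact ⟨x, hw⟩

/-- An expressive risk measure is bounded below by its risk-neutral part plus a positive multiple
of the norm of the position net of cash. -/
lemma IsConvexRiskMeasure.exists_lower_bound {k : ℕ} {Ω : Type*} [Fintype Ω]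
    {φ : Ω → EuclideanSpace ℝ (Fin k)} {rcash : EuclideanSpace ℝ (Fin k)}
    {ρ : EuclideanSpace ℝ (Fin k) → ℝ} (hrisk : IsConvexRiskMeasure φ rcash ρ)
    (hexp : Expressive φ ρ) (hspan : Submodule.span ℝ (Set.range φ) = ⊤)
    {c : ℝ} (hc : ⟪rcash, c • ∑ ω, φ ω⟫ = 1) :
    ∃ δ > 0, ∃ K, ∀ r, δ * ‖r - ⟪r, c • ∑ ω, φ ω⟫ • rcash‖ - K - ⟪r, c • ∑ ω, φ ω⟫ ≤ ρ r := by
  obtain ⟨δ, hδ, K, h⟩ := hexp.exists_linear_growth hrisk.convex hspan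
  refine ⟨δ, hδ, K, fun r => ?_⟩
  have hc0 : c ≠ 0 := by
    rintro rfl
    simp at hc
  set a := ⟪r, c • ∑ ω, φ ω⟫ with ha
  have horth : ⟪r - a • rcash, c • ∑ ω, φ ω⟫ = 0 := by
    rw [inner_sub_left, inner_smul_left, hc, ← ha]
    simp
  rw [inner_smul_right, mul_eq_zero, or_iff_right hc0] at horth
  have h1 := h _ horth
  have h2 := hrisk.cash_invariant (r - a • rcash) a
  rw [sub_add_cancel] at h2
  linarith

section Surplus

variable {k N : ℕ} {S : Finset (Fin N)} {ρ : Fin N → EuclideanSpace ℝ (Fin k) → ℝ}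

lemma bddBelow_wedgeRisk_set {π₀ : EuclideanSpace ℝ (Fin k)} {K : Fin N → ℝ}
    (hK : ∀ i r, -K i - ⟪r, π₀⟫ ≤ ρ i r) (S : Finset (Fin N)) (r : EuclideanSpace ℝ (Fin k)) :
    BddBelow {s : ℝ | ∃ rs : Fin N → EuclideanSpace ℝ (Fin k),
      (∑ i ∈ S, rs i) = r ∧ s = ∑ i ∈ S, ρ i (rs i)} := by
  refine ⟨∑ i ∈ S, -K i - ⟪r, π₀⟫, ?_⟩
  rintro _ ⟨rs, rfl, rfl⟩
  rw [sum_inner, ← Finset.sum_sub_distrib]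
  exact Finset.sum_le_sum fun i _ => hK i _

lemma wedgeRisk_le {π₀ : EuclideanSpace ℝ (Fin k)} {K : Fin N → ℝ}
    (hK : ∀ i r, -K i - ⟪r, π₀⟫ ≤ ρ i r) (S : Finset (Fin N))
    (y : Fin N → EuclideanSpace ℝ (Fin k)) :
    wedgeRisk S ρ (∑ i ∈ S, y i) ≤ ∑ i ∈ S, ρ i (y i) :=
  csInf_le (bddBelow_wedgeRisk_set hK S _) ⟨y, rfl, rfl⟩

lemma surplus_nonneg {π₀ : EuclideanSpace ℝ (Fin k)} {K : Fin N → ℝ}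
    (hK : ∀ i r, -K i - ⟪r, π₀⟫ ≤ ρ i r) (r : Fin N → EuclideanSpace ℝ (Fin k)) :
    0 ≤ surplus S ρ r :=
  sub_nonneg.mpr (wedgeRisk_le hK S r)

/-- An upper bound for the surplus follows from a bound on the improvement at each reallocation. -/
lemma surplus_le {r : Fin N → EuclideanSpace ℝ (Fin k)} {B : ℝ}
    (h : ∀ y : Fin N → EuclideanSpace ℝ (Fin k), ∑ i ∈ S, y i = ∑ i ∈ S, r i →
      ∑ i ∈ S, ρ i (r i) - B ≤ ∑ i ∈ S, ρ i (y i)) :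
    surplus S ρ r ≤ B := by
  have : ∑ i ∈ S, ρ i (r i) - B ≤ wedgeRisk S ρ (∑ i ∈ S, r i) := by
    refine le_csInf ⟨_, r, rfl, rfl⟩ ?_
    rintro _ ⟨y, hy, rfl⟩
    exact h y hy
  unfold surplus
  linarith

variable {f : (Fin N → EuclideanSpace ℝ (Fin k)) → Fin N → EuclideanSpace ℝ (Fin k)}

lemma IsTradeFunction.sum_univ (hf : IsTradeFunction S ρ f)
    (r : Fin N → EuclideanSpace ℝ (Fin k)) : ∑ i, f r i = ∑ i, r i := by
  rw [← Finset.sum_add_sum_compl S, ← Finset.sum_add_sum_compl S r, (hf r).1]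
  congr 1
  exact Finset.sum_congr rfl fun j hj => (hf r).2.2 j (Finset.mem_compl.mp hj)

/-- A trade function is optimal among all reallocations inside its set of agents. -/
lemma IsTradeFunction.sum_le {π₀ : EuclideanSpace ℝ (Fin k)} {K : Fin N → ℝ}
    (hK : ∀ i r, -K i - ⟪r, π₀⟫ ≤ ρ i r) (hf : IsTradeFunction S ρ f)
    {r y : Fin N → EuclideanSpace ℝ (Fin k)} (hsum : ∑ i ∈ S, y i = ∑ i ∈ S, r i)
    (hout : ∀ j ∉ S, y j = r j) : ∑ i, ρ i (f r i) ≤ ∑ i, ρ i (y i) := by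
  obtain ⟨h1, h2, h3⟩ := hf r
  rw [← Finset.sum_add_sum_compl S, ← Finset.sum_add_sum_compl S fun i => ρ i (y i)]
  have hw := wedgeRisk_le hK S y
  rw [hsum, ← h1, ← sub_eq_zero.mp h2] at hw
  refine add_le_add hw (Finset.sum_le_sum fun j hj => ?_)
  rw [h3 j (Finset.mem_compl.mp hj), hout j (Finset.mem_compl.mp hj)]

/-- A trade lowers total risk by a multiple of the squared gradient gap of any two
participating agents. -/
lemma IsTradeFunction.sum_add_sq_le {π₀ : EuclideanSpace ℝ (Fin k)} {K : Fin N → ℝ}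
    (hK : ∀ i r, -K i - ⟪r, π₀⟫ ≤ ρ i r) (hf : IsTradeFunction S ρ f)
    (hconv : ∀ i, ConvexOn ℝ Set.univ (ρ i)) (hd : ∀ i x, DifferentiableAt ℝ (ρ i) x)
    {L : NNReal} (hL0 : 0 < L) (hL : ∀ i, LipschitzWith L (gradient (ρ i)))
    {a b : Fin N} (ha : a ∈ S) (hb : b ∈ S) (r : Fin N → EuclideanSpace ℝ (Fin k)) :
    ∑ i, ρ i (f r i) + (8 * L : ℝ)⁻¹ * ‖gradient (ρ a) (r a) - gradient (ρ b) (r b)‖ ^ 2 ≤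
      ∑ i, ρ i (r i) := by
  set d := gradient (ρ a) (r a) - gradient (ρ b) (r b) with hdef
  set w : Fin N → ℝ := fun i => (if i = b then 1 else 0) - (if i = a then 1 else 0) with hw
  set s : ℝ := (4 * L : ℝ)⁻¹ with hs
  have hle := hf.sum_le hK (r := r) (y := fun i => r i + (w i * s) • d)
    (by
      rw [Finset.sum_add_distrib, ← Finset.sum_smul, ← Finset.sum_mul]
      simp [hw, Finset.sum_sub_distrib, ha, hb])
    (fun j hj => by
      have h1 : j ≠ a := fun h => hj (h ▸ ha)
      have h2 : j ≠ b := fun h => hj (h ▸ hb)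
      simp [hw, h1, h2])
  have hpt : ∀ i, ρ i (r i + (w i * s) • d) ≤ ρ i (r i) + s * (w i * ⟪gradient (ρ i) (r i), d⟫) +
      L * s ^ 2 * ‖d‖ ^ 2 * ((if i = b then 1 else 0) + (if i = a then 1 else 0)) := by
    intro i
    have h1 := (hconv i).le_add_inner_gradient_add_sq (hd i) (hL i) (r i) ((w i * s) • d)
    have h2 : w i ^ 2 ≤ (if i = b then 1 else 0) + (if i = a then 1 else 0) := by
      simp only [hw]
      split_ifs <;> norm_num
    have h3 := mul_le_mul_of_nonneg_left h2 (by positivity : 0 ≤ L * s ^ 2 * ‖d‖ ^ 2)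
    rw [inner_smul_right, norm_smul, mul_pow, Real.norm_eq_abs, sq_abs] at h1
    linarith
  have hsum := Finset.sum_le_sum fun i (_ : i ∈ Finset.univ) => hpt i
  rw [Finset.sum_add_distrib, Finset.sum_add_distrib, ← Finset.mul_sum, ← Finset.mul_sum] at hsum
  have hgap : ∑ i, w i * ⟪gradient (ρ i) (r i), d⟫ = -‖d‖ ^ 2 := by
    simp only [hw, sub_mul, Finset.sum_sub_distrib, ite_mul, one_mul, zero_mul,
      Finset.sum_ite_eq', Finset.mem_univ, if_true]
    rw [← inner_sub_left, ← neg_sub, ← hdef, inner_neg_left, real_inner_self_eq_norm_sq]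
  have htwo : ∑ i : Fin N, (((if i = b then 1 else 0) + (if i = a then 1 else 0) : ℝ)) = 2 := by
    simp [Finset.sum_add_distrib]
    norm_num
  rw [hgap, htwo] at hsum
  have hLr : (0 : ℝ) < L := by exact_mod_cast hL0
  have hcoef : s * -‖d‖ ^ 2 + L * s ^ 2 * ‖d‖ ^ 2 * 2 = -((8 * L : ℝ)⁻¹ * ‖d‖ ^ 2) := by
    rw [hs]
    field_simp
    ring
  linarith

end Surplus

section RandomProcess

variable {β : Type*} {m : ℕ}

/-- One-step decomposition of the expectation of an observable along a random process. -/
lemma sum_prod_mul_traj_succ (p : Fin m → ℝ) (x0 : β) (step : β → Fin m → β) (Ψ : β → ℝ) (t : ℕ) :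
    ∑ ω : Fin (t + 1) → Fin m, (∏ s, p (ω s)) * Ψ (traj x0 step (t + 1) ω) =
      ∑ ω : Fin t → Fin m, (∏ s, p (ω s)) * ∑ i, p i * Ψ (step (traj x0 step t ω) i) := by
  rw [← (Fin.snocEquiv fun _ => Fin m).sum_comp, Fintype.sum_prod_type_right]
  refine Finset.sum_congr rfl fun ω _ => ?_
  rw [Finset.mul_sum]
  refine Finset.sum_congr rfl fun i _ => ?_
  simp [Fin.snocEquiv, traj, Fin.prod_univ_castSucc, mul_assoc]

lemma sum_prod_eq_one {p : Fin m → ℝ} (hpsum : ∑ i, p i = 1) (t : ℕ) :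
    ∑ ω : Fin t → Fin m, ∏ s, p (ω s) = 1 := by
  rw [← Fintype.piFinset_univ, ← Finset.prod_univ_sum]
  simp [hpsum]

lemma traj_induction {Inv : β → Prop} {x0 : β} {step : β → Fin m → β} (h0 : Inv x0)
    (hstep : ∀ x, Inv x → ∀ i, Inv (step x i)) :
    ∀ (t : ℕ) (ω : Fin t → Fin m), Inv (traj x0 step t ω)
  | 0, _ => h0
  | t + 1, _ => hstep _ (traj_induction h0 hstep t _) _

lemma le_inv_of_quadratic_decrease {a : ℕ → ℝ} (ha : ∀ t, 0 ≤ a t)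
    (hstep : ∀ t, a (t + 1) ≤ a t - a t ^ 2) {t : ℕ} (ht : 1 ≤ t) : a t ≤ 1 / t := by
  have hle : ∀ t, a t ≤ 1 := fun t => by nlinarith [ha (t + 1), hstep t, sq_nonneg (a t - 1)]
  suffices h : ∀ t : ℕ, t * a t ≤ 1 by
    rw [le_div_iff₀ (by exact_mod_cast ht)]
    linarith [h t]
  intro t
  induction t with
  | zero => simp
  | succ n ih =>
    push_cast
    have h1 : ((n : ℝ) + 1) * a (n + 1) ≤ (n + 1) * (a n - a n ^ 2) :=
      mul_le_mul_of_nonneg_left (hstep n) (by positivity)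
    nlinarith [mul_le_mul_of_nonneg_right ih (sub_nonneg.mpr (hle n)), sq_nonneg (a n)]

/-- If each random step decreases a nonnegative observable in expectation by a multiple of its
square, then its expectation decays at rate `1 / t`. -/
lemma expectation_traj_le {p : Fin m → ℝ} (hp : ∀ i, 0 ≤ p i) (hpsum : ∑ i, p i = 1)
    {x0 : β} {step : β → Fin m → β} {Inv : β → Prop} (h0 : Inv x0)
    (hinv : ∀ x, Inv x → ∀ i, Inv (step x i)) {Ψ : β → ℝ} (hΨ : ∀ x, 0 ≤ Ψ x)
    {κ : ℝ} (hκ : 0 < κ) (hdec : ∀ x, Inv x → ∑ i, p i * Ψ (step x i) ≤ Ψ x - κ * Ψ x ^ 2)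
    {t : ℕ} (ht : 1 ≤ t) :
    ∑ ω : Fin t → Fin m, (∏ s, p (ω s)) * Ψ (traj x0 step t ω) ≤ κ⁻¹ / t := by
  set e : ℕ → ℝ := fun t => ∑ ω : Fin t → Fin m, (∏ s, p (ω s)) * Ψ (traj x0 step t ω) with he
  have hw : ∀ (t : ℕ) (ω : Fin t → Fin m), 0 ≤ ∏ s, p (ω s) :=
    fun t ω => Finset.prod_nonneg fun s _ => hp _
  have he0 : ∀ t, 0 ≤ e t := fun t => Finset.sum_nonneg fun ω _ => mul_nonneg (hw t ω) (hΨ _)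
  have hstep : ∀ t, e (t + 1) ≤ e t - κ * e t ^ 2 := by
    intro t
    have hjensen : e t ^ 2 ≤ ∑ ω : Fin t → Fin m, (∏ s, p (ω s)) * Ψ (traj x0 step t ω) ^ 2 :=
      Real.pow_arith_mean_le_arith_mean_pow _ _ _ (fun ω _ => hw t ω) (sum_prod_eq_one hpsum t)
        (fun ω _ => hΨ _) 2
    calc e (t + 1) = ∑ ω : Fin t → Fin m, (∏ s, p (ω s)) *
          ∑ i, p i * Ψ (step (traj x0 step t ω) i) := sum_prod_mul_traj_succ ..
      _ ≤ ∑ ω : Fin t → Fin m, (∏ s, p (ω s)) *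
          (Ψ (traj x0 step t ω) - κ * Ψ (traj x0 step t ω) ^ 2) :=
        Finset.sum_le_sum fun ω _ => mul_le_mul_of_nonneg_left
          (hdec _ (traj_induction h0 hinv t ω)) (hw t ω)
      _ = e t - κ * ∑ ω : Fin t → Fin m, (∏ s, p (ω s)) * Ψ (traj x0 step t ω) ^ 2 := by
        rw [he, Finset.mul_sum, ← Finset.sum_sub_distrib]
        exact Finset.sum_congr rfl fun ω _ => by ring
      _ ≤ e t - κ * e t ^ 2 := by nlinarith
  have := le_inv_of_quadratic_decrease (a := fun t => κ * e t)
    (fun t => mul_nonneg hκ.le (he0 t)) (fun t => by nlinarith [hstep t]) ht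
  change e t ≤ _
  rw [inv_eq_one_div, div_div, le_div_iff₀ (by positivity)]
  rw [le_div_iff₀ (by exact_mod_cast ht)] at this
  linarith

end RandomProcess

/-- On a set of allocations which is bounded up to cash, the surplus is controlled by the
gradient gaps between the agents. -/
lemma surplus_le_mul_sum_gradient_gap {k N : ℕ} {ρ : Fin N → EuclideanSpace ℝ (Fin k) → ℝ}
    {rcash π₀ : EuclideanSpace ℝ (Fin k)} (hconv : ∀ i, ConvexOn ℝ Set.univ (ρ i))
    (hd : ∀ i x, DifferentiableAt ℝ (ρ i) x)
    (hcash : ∀ i x, ⟪gradient (ρ i) x, rcash⟫ = -1)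
    {R : EuclideanSpace ℝ (Fin k)} {c B : ℝ} (hB : 0 ≤ B)
    (hbdd : ∀ y : Fin N → EuclideanSpace ℝ (Fin k), ∑ i, y i = R → ∑ i, ρ i (y i) ≤ c →
      ∀ i, ‖y i - ⟪y i, π₀⟫ • rcash‖ ≤ B)
    {r : Fin N → EuclideanSpace ℝ (Fin k)} (hr : ∑ i, r i = R) (hrc : ∑ i, ρ i (r i) ≤ c)
    (j : Fin N) :
    surplus Finset.univ ρ r ≤
      2 * B * ∑ i, ‖gradient (ρ i) (r i) - gradient (ρ j) (r j)‖ := by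
  refine surplus_le fun y hy => ?_
  have hsum0 : 0 ≤ ∑ i, ‖gradient (ρ i) (r i) - gradient (ρ j) (r j)‖ :=
    Finset.sum_nonneg fun i _ => norm_nonneg _
  rcases le_or_gt (∑ i, ρ i (y i)) c with hyc | hyc
  · have hpt : ∀ i, ρ i (r i) - ρ i (y i) ≤ 2 * B *
        ‖gradient (ρ i) (r i) - gradient (ρ j) (r j)‖ + ⟪gradient (ρ j) (r j), r i - y i⟫ := by
      intro i
      set h := gradient (ρ i) (r i) - gradient (ρ j) (r j) with hh
      have h1 := (hconv i).add_inner_gradient_le (hd i (r i)) (y i)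
      have horth : ⟪h, rcash⟫ = 0 := by rw [hh, inner_sub_left, hcash, hcash, sub_self]
      have h2 : ⟪h, r i - y i⟫ =
          ⟪h, (r i - ⟪r i, π₀⟫ • rcash) - (y i - ⟪y i, π₀⟫ • rcash)⟫ := by
        simp only [inner_sub_right, inner_smul_right, horth]
        ring
      have h3 : ⟪h, r i - y i⟫ ≤ ‖h‖ * (B + B) := by
        rw [h2]
        refine (real_inner_le_norm _ _).trans ?_
        gcongr
        exact (norm_sub_le _ _).trans
          (add_le_add (hbdd r hr hrc i) (hbdd y (hy.trans hr) hyc i))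
      have h4 : ⟪gradient (ρ i) (r i), y i - r i⟫ =
          -(⟪h, r i - y i⟫ + ⟪gradient (ρ j) (r j), r i - y i⟫) := by
        rw [hh, ← inner_add_left, sub_add_cancel, ← inner_neg_right, neg_sub]
      linarith
    have := Finset.sum_le_sum fun i (_ : i ∈ Finset.univ) => hpt i
    rw [Finset.sum_sub_distrib, Finset.sum_add_distrib, ← Finset.mul_sum, ← inner_sum,
      Finset.sum_sub_distrib, hy, sub_self, inner_zero_right] at this
    linarith
  · have : 0 ≤ 2 * B * ∑ i, ‖gradient (ρ i) (r i) - gradient (ρ j) (r j)‖ := by positivity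
    linarith

/-- Allocations of a fixed total with bounded total risk are bounded up to cash. -/
lemma exists_bound_net_of_cash {k N : ℕ} {ρ : Fin N → EuclideanSpace ℝ (Fin k) → ℝ}
    {rcash π₀ : EuclideanSpace ℝ (Fin k)} {δ K : Fin N → ℝ} (hδ : ∀ i, 0 < δ i)
    (hlow : ∀ i r, δ i * ‖r - ⟪r, π₀⟫ • rcash‖ - K i - ⟪r, π₀⟫ ≤ ρ i r)
    (R : EuclideanSpace ℝ (Fin k)) (c : ℝ) :
    ∃ B, 0 ≤ B ∧ ∀ y : Fin N → EuclideanSpace ℝ (Fin k), ∑ i, y i = R → ∑ i, ρ i (y i) ≤ c →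
      ∀ i, ‖y i - ⟪y i, π₀⟫ • rcash‖ ≤ B := by
  set A := |c + ∑ i, K i + ⟪R, π₀⟫| with hA
  have hnn : ∀ i, 0 ≤ A / δ i := fun i => div_nonneg (abs_nonneg _) (hδ i).le
  refine ⟨∑ i, A / δ i, Finset.sum_nonneg fun i _ => hnn i, fun y hy hyc i => ?_⟩
  refine le_trans ?_ (Finset.single_le_sum (fun i _ => hnn i) (Finset.mem_univ i))
  rw [le_div_iff₀ (hδ i), mul_comm]
  have h1 := Finset.sum_le_sum fun i (_ : i ∈ Finset.univ) => hlow i (y i)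
  rw [Finset.sum_sub_distrib, Finset.sum_sub_distrib, ← sum_inner, hy] at h1
  have h2 := Finset.single_le_sum
    (f := fun i => δ i * ‖y i - ⟪y i, π₀⟫ • rcash‖)
    (fun i _ => mul_nonneg (hδ i).le (norm_nonneg _)) (Finset.mem_univ i)
  have h3 := le_abs_self (c + ∑ i, K i + ⟪R, π₀⟫)
  linarith

/-- **Convergence rate of connected trade dynamics.**
Let `ρ_1, …, ρ_N` be expressive, strictly risk averse convex risk measures, each with
`σ_i`-Lipschitz gradient, and let `D` be any connected trade dynamic: subsets
`S_1, …, S_m` covering `{1,…,N}` forming a connected hypergraph, trade functions `f_i`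
on `S_i`, and a full-support distribution `p`, an independently drawn `f_i` (chosen with
probability `p_i`) being applied at each step. Then there is a constant `C` such that
the expected surplus after `t` steps satisfies `E[Φ(r^t)] ≤ C/t` for all `t ≥ 1`; the
expectation is the average over all length-`t` index sequences weighted by their
probabilities. -/
theorem connected_trade_dynamic_rate {k N m : ℕ} {Ω : Type*} [Fintype Ω]
    (φ : Ω → EuclideanSpace ℝ (Fin k)) (rcash : EuclideanSpace ℝ (Fin k))
    (hspan : Submodule.span ℝ (Set.range φ) = ⊤)
    (hrcash : ∀ ω, ⟪rcash, φ ω⟫ = 1)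
    (ρ : Fin N → EuclideanSpace ℝ (Fin k) → ℝ)
    (hrisk : ∀ i, IsConvexRiskMeasure φ rcash (ρ i))
    (hexp : ∀ i, Expressive φ (ρ i))
    (hstrict : ∀ i, StrictlyRiskAverse rcash (ρ i))
    (σ : Fin N → NNReal)
    (hsmooth : ∀ i, LipschitzWith (σ i) (gradient (ρ i)))
    (S : Fin m → Finset (Fin N))
    (f : Fin m → (Fin N → EuclideanSpace ℝ (Fin k)) → Fin N → EuclideanSpace ℝ (Fin k))
    (hf : ∀ i, IsTradeFunction (S i) ρ (f i))
    (hcover : ∀ j : Fin N, ∃ i, j ∈ S i)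
    (hconn : ConnectedHypergraph S)
    (p : Fin m → ℝ) (hp : ∀ i, 0 < p i) (hpsum : ∑ i, p i = 1)
    (r0 : Fin N → EuclideanSpace ℝ (Fin k)) :
    ∃ C : ℝ, ∀ t : ℕ, 1 ≤ t →
      (∑ ω : Fin t → Fin m, (∏ s, p (ω s)) *
          surplus Finset.univ ρ (traj r0 (fun r i => f i r) t ω)) ≤ C / t := by
  rcases isEmpty_or_nonempty (Fin N) with hN | ⟨⟨j⟩⟩
  · refine ⟨0, fun t _ => le_of_eq ?_⟩
    simp [surplus, wedgeRisk]
  have hd : ∀ i x, DifferentiableAt ℝ (ρ i) x := fun i => (hexp i).1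
  have hconv : ∀ i, ConvexOn ℝ Set.univ (ρ i) := fun i => (hrisk i).convex
  have hgcash : ∀ i x, ⟪gradient (ρ i) x, rcash⟫ = -1 := fun i x =>
    inner_gradient_eq_neg_one_of_cash_invariant (hrisk i).cash_invariant (hd i x)
  have hΩ : Nonempty Ω := by
    have hne : (closure (Set.range fun x => gradient (ρ j) x)).Nonempty :=
      (Set.range_nonempty _).closure
    rw [(hexp j).2] at hne
    simpa [Set.range_nonempty_iff_nonempty] using hne
  obtain ⟨c, hc⟩ : ∃ c : ℝ, ⟪rcash, c • ∑ ω, φ ω⟫ = 1 :=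
    ⟨(Fintype.card Ω : ℝ)⁻¹, by simp [inner_smul_right, inner_sum, hrcash]⟩
  choose δ hδ K hlow using fun i => (hrisk i).exists_lower_bound (hexp i) hspan hc
  set π₀ := c • ∑ ω, φ ω
  have hK : ∀ i r, -K i - ⟪r, π₀⟫ ≤ ρ i r := fun i r => by
    have := mul_nonneg (hδ i).le (norm_nonneg (r - ⟪r, π₀⟫ • rcash))
    linarith [hlow i r]
  obtain ⟨B, hB, hbdd⟩ := exists_bound_net_of_cash hδ hlow (∑ i, r0 i) (∑ i, ρ i (r0 i))
  obtain ⟨L, hL0, hL⟩ : ∃ L : NNReal, 0 < L ∧ ∀ i, LipschitzWith L (gradient (ρ i)) :=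
    ⟨1 + ∑ i, σ i, by positivity, fun i => (hsmooth i).weaken <|
      (Finset.single_le_sum (fun _ _ => zero_le) (Finset.mem_univ i)).trans le_add_self⟩
  set Φ := surplus Finset.univ ρ with hΦ
  have hdescent : ∀ e, ∀ a ∈ S e, ∀ b ∈ S e, ∀ r, Φ (f e r) +
      (8 * L : ℝ)⁻¹ * ‖gradient (ρ a) (r a) - gradient (ρ b) (r b)‖ ^ 2 ≤ Φ r := by
    intro e a ha b hb r
    have := (hf e).sum_add_sq_le hK hconv hd hL0 hL ha hb r
    simp only [hΦ, surplus, (hf e).sum_univ r]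
    linarith
  have hmono : ∀ e r, ∑ i, ρ i (f e r i) ≤ ∑ i, ρ i (r i) := fun e r =>
    (hf e).sum_le hK rfl fun _ _ => rfl
  have hΦmono : ∀ e r, Φ (f e r) ≤ Φ r := fun e r => by
    simp only [hΦ, surplus, (hf e).sum_univ r]
    linarith [hmono e r]
  set Δ : (Fin N → EuclideanSpace ℝ (Fin k)) → ℝ := fun r => ∑ e, p e * (Φ r - Φ (f e r)) with hΔ
  have hΔ0 : ∀ r, 0 ≤ Δ r := fun r =>
    Finset.sum_nonneg fun e _ => mul_nonneg (hp e).le (sub_nonneg.mpr (hΦmono e r))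
  have hΔeq : ∀ r, ∑ e, p e * Φ (f e r) = Φ r - Δ r := fun r => by
    simp only [hΔ, mul_sub, Finset.sum_sub_distrib, ← Finset.sum_mul, hpsum]
    ring
  have hLr : (0 : ℝ) < L := by exact_mod_cast hL0
  have hlink : ∀ a b, (∃ e, a ∈ S e ∧ b ∈ S e) → ∃ M : ℝ, 0 ≤ M ∧ ∀ r,
      ‖gradient (ρ a) (r a) - gradient (ρ b) (r b)‖ ≤ M * √(Δ r) := by
    rintro a b ⟨e, ha, hb⟩
    refine ⟨√(8 * L / p e), Real.sqrt_nonneg _, fun r => ?_⟩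
    have hpe := hp e
    rw [← Real.sqrt_mul (by positivity)]
    refine Real.le_sqrt_of_sq_le ?_
    have h1 : p e * (Φ r - Φ (f e r)) ≤ Δ r :=
      Finset.single_le_sum (f := fun e => p e * (Φ r - Φ (f e r)))
        (fun e _ => mul_nonneg (hp e).le (sub_nonneg.mpr (hΦmono e r))) (Finset.mem_univ e)
    have h2 := mul_le_mul_of_nonneg_left (le_sub_iff_add_le'.mpr (hdescent e a ha b hb r)) hpe.le
    have h3 := mul_le_mul_of_nonneg_left (h2.trans h1) (by positivity : 0 ≤ 8 * L / p e)
    refine le_trans (le_of_eq ?_) h3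
    field_simp
  have hchain : ∀ a, ∃ M : ℝ, 0 ≤ M ∧ ∀ r,
      ‖gradient (ρ a) (r a) - gradient (ρ j) (r j)‖ ≤ M * √(Δ r) := by
    intro a
    induction hconn a j using Relation.ReflTransGen.head_induction_on with
    | refl => exact ⟨0, le_rfl, by simp⟩
    | head hab _ ih =>
      obtain ⟨M, hM, h⟩ := ih
      obtain ⟨M', hM', h'⟩ := hlink _ _ hab
      refine ⟨M' + M, add_nonneg hM' hM, fun r => ?_⟩
      rw [add_mul]
      exact (norm_sub_le_norm_sub_add_norm_sub _ _ _).trans (add_le_add (h' r) (h r))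
  choose M hM hgap using hchain
  set Q := 2 * B * ∑ i, M i + 1 with hQ
  have hQ0 : 0 < Q := by
    have := Finset.sum_nonneg fun i (_ : i ∈ Finset.univ) => hM i
    positivity
  refine ⟨((Q ^ 2)⁻¹)⁻¹, fun t ht => expectation_traj_le (fun i => (hp i).le) hpsum
    (Inv := fun r => ∑ i, r i = ∑ i, r0 i ∧ ∑ i, ρ i (r i) ≤ ∑ i, ρ i (r0 i)) ⟨rfl, le_rfl⟩
    (fun r hr e => ⟨((hf e).sum_univ r).trans hr.1, (hmono e r).trans hr.2⟩)
    (fun r => surplus_nonneg hK r) (by positivity) (fun r hr => ?_) ht⟩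
  rw [← hΦ, hΔeq]
  have h1 : Φ r ≤ Q * √(Δ r) := by
    have h2 := surplus_le_mul_sum_gradient_gap hconv hd hgcash hB hbdd hr.1 hr.2 j
    have h3 : ∑ i, ‖gradient (ρ i) (r i) - gradient (ρ j) (r j)‖ ≤ (∑ i, M i) * √(Δ r) := by
      rw [Finset.sum_mul]
      exact Finset.sum_le_sum fun i _ => hgap i r
    have h4 := mul_le_mul_of_nonneg_left h3 (by positivity : 0 ≤ 2 * B)
    rw [hQ]
    linarith [Real.sqrt_nonneg (Δ r)]
  have h5 : Φ r ^ 2 ≤ Q ^ 2 * Δ r := by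
    have := pow_le_pow_left₀ (surplus_nonneg hK r) h1 2
    rwa [mul_pow, Real.sq_sqrt (hΔ0 r)] at this
  have h6 : (Q ^ 2)⁻¹ * Φ r ^ 2 ≤ Δ r := by
    rw [inv_mul_le_iff₀ (by positivity)]
    exact h5
  linarith
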